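/- arXiv:2405.00405 — 2 statements merged into one kernel-verified Lean document; each statement's English description precedes it below -/
import Mathlib

section
/- Assume ρ is quasi-pure at x. Then every SLD L of ρ at x vanishes on the support block: ⟨φ_k(x), L φ_l(x)⟩ = 0 for all k, l = 1,…,r, i.e. Π_r(x) L Π_r(x) = 0. -/
open Matrix
open scoped Classical

/-- The rank-one matrix `|v⟩⟨w|`, sending `u` to `⟨w, u⟩ v`. -/
noncomputable def ketbra {n : Type*} (v w : n → ℂ) : Matrix n n ℂ :=
  Matrix.vecMulVec v (star w)

theorem ketbra_mulVec {n : Type*} [Fintype n] (v w u : n → ℂ) :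
    ketbra v w *ᵥ u = (star w ⬝ᵥ u) • v := by
  simp [ketbra, vecMulVec_mulVec]

theorem vecMul_ketbra {n : Type*} [Fintype n] (u v w : n → ℂ) :
    u ᵥ* ketbra v w = (u ⬝ᵥ v) • star w := by
  simp [ketbra, vecMul_vecMulVec]

theorem ketbra_mul_mul_ketbra {n : Type*} [Fintype n] (v w u z : n → ℂ) (A : Matrix n n ℂ) :
    ketbra v w * A * ketbra u z = (star w ⬝ᵥ (A *ᵥ u)) • ketbra v z := by
  rw [ketbra, ketbra, ketbra, vecMulVec_mul, vecMulVec_mul_vecMulVec, ← dotProduct_mulVec,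
    vecMulVec_smul]

/-- Orthonormal vectors are right eigenvectors of the matrix they diagonalise. -/
theorem sum_smul_ketbra_mulVec {n ι : Type*} [Fintype n] [Fintype ι] [DecidableEq ι]
    {φ : ι → n → ℂ}
    (hφ : ∀ i j, star (φ i) ⬝ᵥ φ j = if i = j then 1 else 0) (c : ι → ℂ) (j : ι) :
    (∑ i, c i • ketbra (φ i) (φ i)) *ᵥ φ j = c j • φ j := by
  simp [sum_mulVec, smul_mulVec, ketbra_mulVec, hφ]

/-- Orthonormal vectors are, after conjugation, left eigenvectors of the matrix they
diagonalise. -/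
theorem star_vecMul_sum_smul_ketbra {n ι : Type*} [Fintype n] [Fintype ι] [DecidableEq ι]
    {φ : ι → n → ℂ}
    (hφ : ∀ i j, star (φ i) ⬝ᵥ φ j = if i = j then 1 else 0) (c : ι → ℂ) (j : ι) :
    star (φ j) ᵥ* (∑ i, c i • ketbra (φ i) (φ i)) = c j • star (φ j) := by
  simp [vecMul_sum, vecMul_smul, vecMul_ketbra, hφ]

/-- If `ρ(x) = ∑ₙ qₙ(x)|φₙ(x)⟩⟨φₙ(x)|` is quasi-pure at `x`, then every
SLD `L` of `ρ` at `x` vanishes on the support block: `⟨φₖ(x), L φₗ(x)⟩ = 0` for all `k, l`,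
i.e. `Π_r(x) L Π_r(x) = 0`. -/
theorem sld_vanishes_on_support_block_of_quasiPure
    {d r : ℕ}
    (ρ : ℝ → Matrix (Fin d) (Fin d) ℂ)
    (q : Fin r → ℝ → ℝ) (φ : Fin r → ℝ → Fin d → ℂ)
    (hortho : ∀ x m n, star (φ m x) ⬝ᵥ φ n x = if m = n then 1 else 0)
    (hqpos : ∀ x n, 0 < q n x)
    (hqsum : ∀ x, ∑ n, q n x = 1)
    (hspec : ∀ x, ρ x = ∑ n, (q n x : ℂ) • ketbra (φ n x) (φ n x))
    (x : ℝ)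
    (q' : Fin r → ℝ) (hq' : ∀ n, HasDerivAt (q n) (q' n) x)
    (φ' : Fin r → Fin d → ℂ)
    (hφ' : ∀ n i, HasDerivAt (fun y => φ n y i) (φ' n i) x)
    (ρ' : Matrix (Fin d) (Fin d) ℂ)
    (hρ' : ∀ i j, HasDerivAt (fun y => ρ y i j) (ρ' i j) x)
    (hquasipure : ∀ k l, star (φ k x) ⬝ᵥ (ρ' *ᵥ φ l x) = 0)
    (L : Matrix (Fin d) (Fin d) ℂ)
    (hL : L.IsHermitian)
    (hSLD : ρ' = (1/2 : ℂ) • (L * ρ x + ρ x * L)) :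
    (∀ k l, star (φ k x) ⬝ᵥ (L *ᵥ φ l x) = 0) ∧
    (∑ n, ketbra (φ n x) (φ n x)) * L * (∑ n, ketbra (φ n x) (φ n x)) = 0 := by
  have hblock : ∀ k l, star (φ k x) ⬝ᵥ (L *ᵥ φ l x) = 0 := by
    intro k l
    have hqp := hquasipure k l
    rw [hSLD, smul_mulVec, dotProduct_smul, add_mulVec, dotProduct_add, ← mulVec_mulVec,
      ← mulVec_mulVec, dotProduct_mulVec _ (ρ x), hspec x,
      sum_smul_ketbra_mulVec (hortho x) (fun n => (q n x : ℂ)),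
      star_vecMul_sum_smul_ketbra (hortho x) (fun n => (q n x : ℂ)),
      mulVec_smul, dotProduct_smul, smul_dotProduct, ← add_smul, smul_smul, smul_eq_mul] at hqp
    have hne : (q l x : ℂ) + q k x ≠ 0 := by
      exact_mod_cast (add_pos (hqpos x l) (hqpos x k)).ne'
    exact (mul_eq_zero.mp hqp).resolve_left (mul_ne_zero (by norm_num) hne)
  refine ⟨hblock, ?_⟩
  simp [Finset.sum_mul, Finset.mul_sum, ketbra_mul_mul_ketbra, hblock]
end

section
/- Let ψ : ℝ → ℂ^d be differentiable with ‖ψ(x)‖ = 1 for all x, fix x₀ with 𝒟ψ(x₀) ≠ 0, set ψ^⊥ = 𝒟ψ(x₀)/‖𝒟ψ(x₀)‖, fix λ ∈ (0,1), and let M = |ψ^⊥⟩⟨ψ^⊥| + √λ |ψ(x₀)⟩⟨ψ(x₀)|. Define ρ(y) = |ψ(y)⟩⟨ψ(y)| and σ(y) = M ρ(y) M / Tr[M ρ(y) M]. Then the postselected state satisfies σ(x₀) = ρ(x₀) and its derivative is amplified: σ'(x₀) = (1/√λ) ρ'(x₀). -/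
open Matrix
open scoped Classical

theorem ketbra_mul_ketbra {n : Type*} [Fintype n] (u v w x : n → ℂ) :
    ketbra u v * ketbra w x = (star v ⬝ᵥ w) • ketbra u x := by
  simp [ketbra, vecMulVec_mul_vecMulVec]

theorem trace_ketbra {n : Type*} [Fintype n] (v w : n → ℂ) :
    (ketbra v w).trace = star w ⬝ᵥ v := by
  rw [ketbra, trace_vecMulVec, dotProduct_comm]

/-- For a unit vector `v` orthogonal to `p`, the filter `|p⟩⟨p| + s |v⟩⟨v|` multiplies the
projector on `v` by `s ^ 2`. -/
theorem filter_mul_ketbra_self_mul_filter {n : Type*} [Fintype n] {v p : n → ℂ} (s : ℂ)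
    (hv : star v ⬝ᵥ v = 1) (hvp : star v ⬝ᵥ p = 0) (hpv : star p ⬝ᵥ v = 0) :
    (ketbra p p + s • ketbra v v) * ketbra v v * (ketbra p p + s • ketbra v v) =
      (s ^ 2) • ketbra v v := by
  simp [add_mul, mul_add, ketbra_mul_ketbra, hv, hvp, hpv, smul_smul, sq]

/-- For orthonormal `v` and `p`, the filter `|p⟩⟨p| + s |v⟩⟨v|` multiplies the coherences
between `v` and `p` by `s`. -/
theorem filter_mul_coherence_mul_filter {n : Type*} [Fintype n] {v p : n → ℂ} (s : ℂ)
    (hv : star v ⬝ᵥ v = 1) (hp : star p ⬝ᵥ p = 1)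
    (hvp : star v ⬝ᵥ p = 0) (hpv : star p ⬝ᵥ v = 0) :
    (ketbra p p + s • ketbra v v) * (ketbra p v + ketbra v p) *
        (ketbra p p + s • ketbra v v) =
      s • (ketbra p v + ketbra v p) := by
  simp [add_mul, mul_add, ketbra_mul_ketbra, hv, hp, hvp, hpv, add_comm]

theorem hasDerivAt_mul_mul_apply {n : Type*} [Fintype n] (A B : Matrix n n ℂ)
    {R : ℝ → Matrix n n ℂ} {R' : Matrix n n ℂ} {x : ℝ}
    (hR : ∀ i j, HasDerivAt (fun y => R y i j) (R' i j) x) (i j : n) :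
    HasDerivAt (fun y => (A * R y * B) i j) ((A * R' * B) i j) x := by
  simp only [mul_apply]
  exact HasDerivAt.fun_sum fun k _ =>
    (HasDerivAt.fun_sum fun l _ => (hR l k).const_mul (A i l)).mul_const (B k j)

theorem hasDerivAt_trace {n : Type*} [Fintype n] {R : ℝ → Matrix n n ℂ} {R' : Matrix n n ℂ}
    {x : ℝ} (hR : ∀ i j, HasDerivAt (fun y => R y i j) (R' i j) x) :
    HasDerivAt (fun y => (R y).trace) R'.trace x :=
  HasDerivAt.fun_sum fun k _ => hR k k

theorem hasDerivAt_ketbra_apply {n : Type*} {v : ℝ → n → ℂ} {v' : n → ℂ} {x : ℝ}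
    (hv : ∀ i, HasDerivAt (fun y => v y i) (v' i) x) (i j : n) :
    HasDerivAt (fun y => ketbra (v y) (v y) i j)
      ((ketbra v' (v x) + ketbra (v x) v') i j) x := by
  simpa [ketbra, vecMulVec_apply] using (hv i).fun_mul (hv j).star

/-- The squared norm `⟨v, v⟩` of a nonzero vector is the square of a nonzero real number. -/
theorem exists_sqrt_star_dotProduct_self {n : Type*} [Fintype n] {v : n → ℂ} (hv : v ≠ 0) :
    ∃ r : ℝ, r ≠ 0 ∧ r = Real.sqrt (star v ⬝ᵥ v).re ∧ star v ⬝ᵥ v = (r : ℂ) ^ 2 := by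
  open scoped ComplexOrder in
  have hpos : 0 < star v ⬝ᵥ v := dotProduct_star_self_pos_iff.mpr hv
  obtain ⟨hre, him⟩ := Complex.pos_iff.mp hpos
  refine ⟨_, (Real.sqrt_pos.mpr hre).ne', rfl, ?_⟩
  rw [← Complex.ofReal_pow, Real.sq_sqrt hre.le]
  exact Complex.ext rfl him.symm

/-- Let `ψ : ℝ → ℂ^d` be a differentiable family of unit vectors, fix `x₀`
with covariant derivative `𝒟ψ(x₀) = ψ'(x₀) − ⟨ψ(x₀), ψ'(x₀)⟩ ψ(x₀) ≠ 0`, set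
`ψ⊥ = 𝒟ψ(x₀)/‖𝒟ψ(x₀)‖`, fix `λ ∈ (0,1)`, and let
`M = |ψ⊥⟩⟨ψ⊥| + √λ |ψ(x₀)⟩⟨ψ(x₀)|`. With `ρ(y) = |ψ(y)⟩⟨ψ(y)|` and
`σ(y) = M ρ(y) M / Tr[M ρ(y) M]`, the postselected state satisfies `σ(x₀) = ρ(x₀)` and its
derivative is amplified: `σ'(x₀) = (1/√λ) ρ'(x₀)`. -/
theorem pure_state_lossless_postselection
    {d : ℕ}
    (ψ : ℝ → Fin d → ℂ)
    (hunit : ∀ x, star (ψ x) ⬝ᵥ ψ x = 1)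
    (x₀ : ℝ)
    (ψ' : Fin d → ℂ)
    (hψ' : ∀ i, HasDerivAt (fun y => ψ y i) (ψ' i) x₀)
    (Dψ : Fin d → ℂ)
    (hDψ : Dψ = ψ' - (star (ψ x₀) ⬝ᵥ ψ') • ψ x₀)
    (hDψne : Dψ ≠ 0)
    (ψperp : Fin d → ℂ)
    (hψperp : ψperp = ((Real.sqrt ((star Dψ ⬝ᵥ Dψ).re) : ℂ))⁻¹ • Dψ)
    (lam : ℝ) (hlam : lam ∈ Set.Ioo (0 : ℝ) 1)
    (M : Matrix (Fin d) (Fin d) ℂ)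
    (hM : M = ketbra ψperp ψperp + (Real.sqrt lam : ℂ) • ketbra (ψ x₀) (ψ x₀))
    (ρ : ℝ → Matrix (Fin d) (Fin d) ℂ)
    (hρ : ∀ y, ρ y = ketbra (ψ y) (ψ y))
    (ρ' : Matrix (Fin d) (Fin d) ℂ)
    (hρ' : ∀ i j, HasDerivAt (fun y => ρ y i j) (ρ' i j) x₀)
    (σ : ℝ → Matrix (Fin d) (Fin d) ℂ)
    (hσ : ∀ y, σ y = ((M * ρ y * M).trace)⁻¹ • (M * ρ y * M)) :
    σ x₀ = ρ x₀ ∧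
    ∀ i j, HasDerivAt (fun y => σ y i j) (((Real.sqrt lam : ℂ))⁻¹ * ρ' i j) x₀ := by
  obtain ⟨r, hr0, hr, hDD⟩ := exists_sqrt_star_dotProduct_self hDψne
  rw [← hr] at hψperp
  have hrC : (r : ℂ) ≠ 0 := Complex.ofReal_ne_zero.mpr hr0
  set s : ℂ := (Real.sqrt lam : ℂ)
  have hs0 : s ≠ 0 := Complex.ofReal_ne_zero.mpr (Real.sqrt_pos.mpr hlam.1).ne'
  have hv := hunit x₀
  have hvD : star (ψ x₀) ⬝ᵥ Dψ = 0 := by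
    rw [hDψ, dotProduct_sub, dotProduct_smul, hv, smul_eq_mul, mul_one, sub_self]
  have hvp : star (ψ x₀) ⬝ᵥ ψperp = 0 := by
    rw [hψperp, dotProduct_smul, hvD, smul_zero]
  have hpv : star ψperp ⬝ᵥ ψ x₀ = 0 := by
    rw [star_dotProduct, hvp, star_zero]
  have hp : star ψperp ⬝ᵥ ψperp = 1 := by
    rw [hψperp, star_smul, smul_dotProduct, dotProduct_smul, hDD]
    simp only [star_inv₀, Complex.star_def, Complex.conj_ofReal, smul_eq_mul]
    field_simp
  have hψ'eq : ψ' = (r : ℂ) • ψperp + (star (ψ x₀) ⬝ᵥ ψ') • ψ x₀ := by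
    rw [hψperp, smul_smul, mul_inv_cancel₀ hrC, one_smul, hDψ, sub_add_cancel]
  generalize star (ψ x₀) ⬝ᵥ ψ' = c at hψ'eq
  have hρfun : ρ = fun y => ketbra (ψ y) (ψ y) := funext hρ
  have hρ'eq : ρ' = ketbra ψ' (ψ x₀) + ketbra (ψ x₀) ψ' := by
    ext i j
    refine (hρ' i j).unique ?_
    simpa only [hρfun] using hasDerivAt_ketbra_apply hψ' i j
  have htrρ : ∀ y, (ρ y).trace = 1 := fun y => by rw [hρ, trace_ketbra, hunit]
  have htrρ' : ρ'.trace = 0 := by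
    refine (hasDerivAt_trace hρ').unique ?_
    simpa only [htrρ] using hasDerivAt_const x₀ (1 : ℂ)
  have hρ'exp : ρ' = (r : ℂ) • (ketbra ψperp (ψ x₀) + ketbra (ψ x₀) ψperp) +
      (c + star c) • ketbra (ψ x₀) (ψ x₀) := by
    rw [hρ'eq, hψ'eq]
    ext i j
    simp [ketbra, vecMulVec_apply]
    ring
  have hc : c + star c = 0 := by
    rw [hρ'exp] at htrρ'
    simpa [trace_ketbra, hv, hvp, hpv] using htrρ'
  rw [hc, zero_smul, add_zero] at hρ'exp
  have hMρ : M * ρ x₀ * M = (s ^ 2) • ρ x₀ := by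
    rw [hM, hρ, filter_mul_ketbra_self_mul_filter s hv hvp hpv]
  have hMρ' : M * ρ' * M = s • ρ' := by
    rw [hM, hρ'exp, Matrix.mul_smul, Matrix.smul_mul,
      filter_mul_coherence_mul_filter s hv hp hvp hpv, smul_comm]
  have htr : (M * ρ x₀ * M).trace = s ^ 2 := by
    rw [hMρ, trace_smul, htrρ, smul_eq_mul, mul_one]
  have hs2 : s ^ 2 ≠ 0 := pow_ne_zero 2 hs0
  have hderiv := hasDerivAt_mul_mul_apply M M hρ'
  refine ⟨by rw [hσ, htr, hMρ, smul_smul, inv_mul_cancel₀ hs2, one_smul], fun i j => ?_⟩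
  have htr' := hasDerivAt_trace hderiv
  have h := (htr'.fun_inv (by rwa [htr])).fun_mul (hderiv i j)
  simp only [htr, hMρ', trace_smul, htrρ', mul_zero, neg_zero, zero_div, zero_mul,
    zero_add, Matrix.smul_apply, smul_eq_mul] at h
  simp only [hσ, Matrix.smul_apply, smul_eq_mul]
  exact h.congr_deriv (by field_simp)
end
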